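/- arXiv:2406.18316 — 4 statements merged into one kernel-verified Lean document; each statement's English description precedes it below -/
import Mathlib

section
/- Let 𝒢_Lie be a Lie-closed set of n-qubit Pauli strings. If P and Q are n-qubit Pauli strings with P ≠ Q that are 𝔤-connected with respect to 𝒢_Lie, then either P anticommutes with Q, or there exists R ∈ 𝒢_Lie such that R anticommutes with P and R anticommutes with Q (i.e., the shortest path between P and Q in the anticommutation graph has length one or two). -/
open Matrix

noncomputable section

/-- The four single-qubit Pauli matrices: I, X, Y, Z. -/
def pauli1 : Fin 4 → Matrix (Fin 2) (Fin 2) ℂ :=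
  ![1, !![0, 1; 1, 0], !![0, -Complex.I; Complex.I, 0], !![1, 0; 0, -1]]

/-- The `n`-qubit Pauli string determined by `f : Fin n → Fin 4`. -/
def PauliString (n : ℕ) (f : Fin n → Fin 4) :
    Matrix (Fin n → Fin 2) (Fin n → Fin 2) ℂ :=
  fun x y => ∏ i, pauli1 (f i) (x i) (y i)

/-- Two matrices commute. -/
def MComm {n : ℕ} (A B : Matrix (Fin n → Fin 2) (Fin n → Fin 2) ℂ) : Prop :=
  A * B = B * A

/-- Two matrices anticommute. -/
def MAntiComm {n : ℕ} (A B : Matrix (Fin n → Fin 2) (Fin n → Fin 2) ℂ) : Prop :=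
  A * B = -(B * A)

/-- A matrix is an `n`-qubit Pauli string. -/
def IsPauli {n : ℕ} (A : Matrix (Fin n → Fin 2) (Fin n → Fin 2) ℂ) : Prop :=
  ∃ f : Fin n → Fin 4, A = PauliString n f

/-- A set of `n`-qubit Pauli strings is Lie-closed: whenever two of its members
anticommute, the (unique) Pauli string appearing, up to a unit scalar, in their
product also belongs to the set. -/
def LieClosed {n : ℕ} (𝒢 : Set (Matrix (Fin n → Fin 2) (Fin n → Fin 2) ℂ)) : Prop :=
  ∀ P ∈ 𝒢, ∀ Q ∈ 𝒢, MAntiComm P Q →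
    ∀ (c : ℂ) (R : Matrix (Fin n → Fin 2) (Fin n → Fin 2) ℂ),
      ‖c‖ = 1 → IsPauli R → P * Q = c • R → R ∈ 𝒢

/-- `P` and `Q` are `𝔤`-connected with respect to `𝒢`: they are distinct and
joined by a chain of anticommutations passing through elements of `𝒢`
(the empty chain meaning that `P` and `Q` themselves anticommute). -/
def GConnected {n : ℕ} (𝒢 : Set (Matrix (Fin n → Fin 2) (Fin n → Fin 2) ℂ))
    (P Q : Matrix (Fin n → Fin 2) (Fin n → Fin 2) ℂ) : Prop :=
  P ≠ Q ∧ ∃ l : List (Matrix (Fin n → Fin 2) (Fin n → Fin 2) ℂ),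
    (∀ R ∈ l, R ∈ 𝒢) ∧ List.Chain' MAntiComm (P :: (l ++ [Q]))

theorem pauliString_mul_apply {n : ℕ} (f g : Fin n → Fin 4) (x y : Fin n → Fin 2) :
    (PauliString n f * PauliString n g) x y =
      ∏ i, (pauli1 (f i) * pauli1 (g i)) (x i) (y i) := by
  simp only [Matrix.mul_apply, PauliString, ← Finset.prod_mul_distrib]
  rw [Finset.prod_univ_sum, Fintype.piFinset_univ]

theorem pauli1_mul (a b : Fin 4) :
    ∃ (c : ℂ) (d : Fin 4), ‖c‖ = 1 ∧ pauli1 a * pauli1 b = c • pauli1 d := by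
  refine ⟨!![1, 1, 1, 1; 1, 1, .I, -.I; 1, -.I, 1, .I; 1, .I, -.I, 1] a b,
    !![0, 1, 2, 3; 1, 0, 3, 2; 2, 3, 0, 1; 3, 2, 1, 0] a b, ?_, ?_⟩
  · fin_cases a <;> fin_cases b <;> simp
  · ext i j
    fin_cases a <;> fin_cases b <;> fin_cases i <;> fin_cases j <;> simp [pauli1]

theorem pauli1_mul_comm_or_anticomm (a b : Fin 4) :
    ∃ s : ℤˣ, pauli1 a * pauli1 b = ((s : ℤ) : ℂ) • (pauli1 b * pauli1 a) := by
  suffices h : pauli1 a * pauli1 b = pauli1 b * pauli1 a ∨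
      pauli1 a * pauli1 b = -(pauli1 b * pauli1 a) by
    rcases h with h | h
    · exact ⟨1, by simpa using h⟩
    · exact ⟨-1, by simpa using h⟩
  fin_cases a <;> fin_cases b <;> first
    | (left; ext i j; fin_cases i <;> fin_cases j <;> simp [pauli1]; done)
    | (right; ext i j; fin_cases i <;> fin_cases j <;> simp [pauli1])

theorem IsPauli.exists_mul_eq_smul {n : ℕ} {A B : Matrix (Fin n → Fin 2) (Fin n → Fin 2) ℂ}
    (hA : IsPauli A) (hB : IsPauli B) :
    ∃ (c : ℂ) (R : Matrix (Fin n → Fin 2) (Fin n → Fin 2) ℂ),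
      ‖c‖ = 1 ∧ IsPauli R ∧ A * B = c • R := by
  obtain ⟨f, rfl⟩ := hA
  obtain ⟨g, rfl⟩ := hB
  choose c d hc hd using fun i => pauli1_mul (f i) (g i)
  refine ⟨∏ i, c i, PauliString n d, by simp [hc], ⟨d, rfl⟩, ?_⟩
  ext x y
  simp [pauliString_mul_apply, hd, PauliString, Finset.prod_mul_distrib]

theorem IsPauli.comm_or_anticomm {n : ℕ} {A B : Matrix (Fin n → Fin 2) (Fin n → Fin 2) ℂ}
    (hA : IsPauli A) (hB : IsPauli B) : MComm A B ∨ MAntiComm A B := by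
  obtain ⟨f, rfl⟩ := hA
  obtain ⟨g, rfl⟩ := hB
  choose s hs using fun i => pauli1_mul_comm_or_anticomm (f i) (g i)
  have h : PauliString n f * PauliString n g =
      (((∏ i, s i : ℤˣ) : ℤ) : ℂ) • (PauliString n g * PauliString n f) := by
    ext x y
    simp [pauliString_mul_apply, hs, Finset.prod_mul_distrib]
  rcases Int.units_eq_one_or (∏ i, s i) with h1 | h1
  · left; simpa [h1, MComm] using h
  · right; simpa [h1, MAntiComm] using h

theorem MAntiComm.symm {n : ℕ} {A B : Matrix (Fin n → Fin 2) (Fin n → Fin 2) ℂ}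
    (h : MAntiComm A B) : MAntiComm B A := by
  rw [MAntiComm] at *
  rw [h, neg_neg]

theorem MAntiComm.of_smul_left {n : ℕ} {A B : Matrix (Fin n → Fin 2) (Fin n → Fin 2) ℂ} {c : ℂ}
    (hc : c ≠ 0) (h : MAntiComm (c • A) B) : MAntiComm A B := by
  rw [MAntiComm, Matrix.smul_mul, Matrix.mul_smul, ← smul_neg] at h
  exact smul_right_injective _ hc h

theorem MAntiComm.mul_left_of_comm {n : ℕ} {A B C : Matrix (Fin n → Fin 2) (Fin n → Fin 2) ℂ}
    (hA : MAntiComm A C) (hB : MComm B C) : MAntiComm (A * B) C := by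
  rw [MAntiComm, MComm] at *
  rw [mul_assoc, hB, ← mul_assoc, hA, neg_mul, mul_assoc]

theorem MComm.mul_left_of_anticomm {n : ℕ} {A B C : Matrix (Fin n → Fin 2) (Fin n → Fin 2) ℂ}
    (hA : MComm A C) (hB : MAntiComm B C) : MAntiComm (A * B) C := by
  rw [MAntiComm, MComm] at *
  rw [mul_assoc, hB, mul_neg, ← mul_assoc, hA, mul_assoc]

/-- In a Lie-closed set, a path of any length between two Pauli strings can be shortened to one
of length at most two. -/
theorem LieClosed.anticomm_or_exists_of_isChain {n : ℕ}
    {𝒢 : Set (Matrix (Fin n → Fin 2) (Fin n → Fin 2) ℂ)}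
    (hpauli : ∀ A ∈ 𝒢, IsPauli A) (hlie : LieClosed 𝒢)
    {Q : Matrix (Fin n → Fin 2) (Fin n → Fin 2) ℂ} (hQ : IsPauli Q)
    (l : List (Matrix (Fin n → Fin 2) (Fin n → Fin 2) ℂ)) (hl : ∀ R ∈ l, R ∈ 𝒢)
    {P : Matrix (Fin n → Fin 2) (Fin n → Fin 2) ℂ} (hP : IsPauli P)
    (hchain : List.IsChain MAntiComm (P :: (l ++ [Q]))) :
    MAntiComm P Q ∨ ∃ R ∈ 𝒢, MAntiComm R P ∧ MAntiComm R Q := by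
  induction l generalizing P with
  | nil => left; simpa using hchain
  | cons R l ih =>
    rw [List.cons_append, List.isChain_cons_cons] at hchain
    obtain ⟨hPR, hchain⟩ := hchain
    have hR : R ∈ 𝒢 := hl R (by simp)
    right
    rcases (hpauli R hR).comm_or_anticomm hQ with hRQ | hRQ
    swap
    · exact ⟨R, hR, hPR.symm, hRQ⟩
    rcases ih (fun S hS => hl S (by simp [hS])) (hpauli R hR) hchain with
      hRQ' | ⟨S, hS, hSR, hSQ⟩
    · exact ⟨R, hR, hPR.symm, hRQ'⟩
    rcases (hpauli S hS).comm_or_anticomm hP with hSP | hSP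
    swap
    · exact ⟨S, hS, hSP, hSQ⟩
    obtain ⟨c, T, hc, hT, hmul⟩ := (hpauli R hR).exists_mul_eq_smul (hpauli S hS)
    have hc0 : c ≠ 0 := by rintro rfl; simp at hc
    refine ⟨T, hlie R hR S hS hSR.symm c T hc hT hmul, ?_, ?_⟩
    · exact .of_smul_left hc0 (hmul ▸ hPR.symm.mul_left_of_comm hSP)
    · exact .of_smul_left hc0 (hmul ▸ hRQ.mul_left_of_anticomm hSQ)

/-- **Lemma 6.** If two distinct Pauli strings `P` and `Q` are
`𝔤`-connected with respect to a Lie-closed set `𝒢`, then the shortest path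
between them in the anticommutation graph has length one or two: either `P`
anticommutes with `Q`, or some `R ∈ 𝒢` anticommutes with both. -/
theorem shortest_distance_le_two
    {n : ℕ} (hn : 1 ≤ n)
    (𝒢 : Set (Matrix (Fin n → Fin 2) (Fin n → Fin 2) ℂ))
    (h𝒢pauli : ∀ A ∈ 𝒢, IsPauli A) (h𝒢lie : LieClosed 𝒢)
    (P Q : Matrix (Fin n → Fin 2) (Fin n → Fin 2) ℂ)
    (hP : IsPauli P) (hQ : IsPauli Q) (hne : P ≠ Q)
    (hconn : GConnected 𝒢 P Q) :
    MAntiComm P Q ∨ ∃ R ∈ 𝒢, MAntiComm R P ∧ MAntiComm R Q := by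
  obtain ⟨-, l, hl, hchain⟩ := hconn
  exact h𝒢lie.anticomm_or_exists_of_isChain h𝒢pauli hQ l hl hP hchain
end
end

section
/- If S is a finite set of n-qubit Pauli strings such that any two elements of S commute with each other, then the cardinality of S is at most 2^n. -/
open Matrix

noncomputable section

/-- The tensor product of a family of `2 × 2` matrices, one for each qubit. -/
def qubitTensor {n : ℕ} (A : Fin n → Matrix (Fin 2) (Fin 2) ℂ) :
    Matrix (Fin n → Fin 2) (Fin n → Fin 2) ℂ :=
  fun x y => ∏ i, A i (x i) (y i)

theorem pauliString_eq_qubitTensor {n : ℕ} (f : Fin n → Fin 4) :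
    PauliString n f = qubitTensor fun i => pauli1 (f i) := rfl

theorem qubitTensor_mul {n : ℕ} (A B : Fin n → Matrix (Fin 2) (Fin 2) ℂ) :
    qubitTensor A * qubitTensor B = qubitTensor fun i => A i * B i := by
  ext x y
  simp only [qubitTensor, Matrix.mul_apply, Finset.prod_univ_sum, Fintype.piFinset_univ,
    Finset.prod_mul_distrib]

theorem qubitTensor_smul {n : ℕ} (c : Fin n → ℂ) (A : Fin n → Matrix (Fin 2) (Fin 2) ℂ) :
    (qubitTensor fun i => c i • A i) = (∏ i, c i) • qubitTensor A := by
  ext x y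
  simp [qubitTensor, Finset.prod_mul_distrib]

theorem qubitTensor_one {n : ℕ} :
    (qubitTensor fun _ => 1 : Matrix (Fin n → Fin 2) (Fin n → Fin 2) ℂ) = 1 := by
  ext x y
  by_cases h : x = y
  · subst h
    simp [qubitTensor]
  · obtain ⟨i, hi⟩ := Function.ne_iff.mp h
    rw [Matrix.one_apply_ne h]
    exact Finset.prod_eq_zero (Finset.mem_univ i) (Matrix.one_apply_ne hi)

/-- The commutation sign of two single-qubit Pauli matrices. -/
def pauliSign (a b : Fin 4) : ℤ :=
  if a = 0 ∨ b = 0 ∨ a = b then 1 else -1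

theorem pauli1_mul_comm (a b : Fin 4) :
    pauli1 a * pauli1 b = (pauliSign a b : ℂ) • (pauli1 b * pauli1 a) := by
  fin_cases a <;> fin_cases b <;> ext i j <;> fin_cases i <;> fin_cases j <;>
    simp [pauli1, pauliSign]

theorem pauli1_mul_self (a : Fin 4) : pauli1 a * pauli1 a = 1 := by
  fin_cases a <;> ext i j <;> fin_cases i <;> fin_cases j <;> simp [pauli1]

theorem sum_pauliSign_mul (a b : Fin 4) :
    ∑ c, pauliSign a c * pauliSign b c = if a = b then 4 else 0 := by
  revert a b
  decide

/-- The commutation sign of two Pauli strings. -/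
def pauliStringSign {n : ℕ} (f g : Fin n → Fin 4) : ℤ :=
  ∏ i, pauliSign (f i) (g i)

theorem pauliString_mul_comm {n : ℕ} (f g : Fin n → Fin 4) :
    PauliString n f * PauliString n g =
      (pauliStringSign f g : ℂ) • (PauliString n g * PauliString n f) := by
  simp only [pauliString_eq_qubitTensor, qubitTensor_mul, pauliStringSign, Int.cast_prod,
    ← qubitTensor_smul, ← pauli1_mul_comm]

theorem pauliString_mul_self {n : ℕ} (f : Fin n → Fin 4) :
    PauliString n f * PauliString n f = 1 := by
  simp only [pauliString_eq_qubitTensor, qubitTensor_mul, pauli1_mul_self, qubitTensor_one]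

theorem pauliStringSign_eq_one {n : ℕ} {f g : Fin n → Fin 4}
    (h : MComm (PauliString n f) (PauliString n g)) : pauliStringSign f g = 1 := by
  have hcomm := pauliString_mul_comm f g
  rw [h] at hcomm
  have hone : (1 : Matrix (Fin n → Fin 2) (Fin n → Fin 2) ℂ) =
      (pauliStringSign f g : ℂ) • 1 := by
    have hmul := congrArg (fun M => PauliString n g * M * PauliString n f) hcomm
    simpa only [Matrix.mul_smul, Matrix.smul_mul, ← Matrix.mul_assoc, pauliString_mul_self,
      Matrix.one_mul] using hmul
  have hentry := congrFun (congrFun hone 0) 0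
  simp only [Matrix.smul_apply, Matrix.one_apply_eq, smul_eq_mul, mul_one] at hentry
  exact_mod_cast hentry.symm

theorem sum_pauliStringSign_mul {n : ℕ} (f g : Fin n → Fin 4) :
    ∑ h, pauliStringSign f h * pauliStringSign g h = if f = g then 4 ^ n else 0 := by
  have hsum := Finset.prod_univ_sum (fun _ : Fin n => (Finset.univ : Finset (Fin 4)))
    (fun i c => pauliSign (f i) c * pauliSign (g i) c)
  simp only [Fintype.piFinset_univ, Finset.prod_mul_distrib, sum_pauliSign_mul] at hsum
  simp only [pauliStringSign, ← hsum]
  split_ifs with hfg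
  · simp [hfg]
  · obtain ⟨i, hi⟩ := Function.ne_iff.mp hfg
    exact Finset.prod_eq_zero (Finset.mem_univ i) (if_neg hi)

/-- Parseval's identity for the commutation signs, applied to an indicator function. -/
theorem sum_sq_sum_pauliStringSign {n : ℕ} (T : Finset (Fin n → Fin 4)) :
    ∑ h, (∑ f ∈ T, pauliStringSign f h) ^ 2 = 4 ^ n * (T.card : ℤ) := by
  simp only [sq, Finset.sum_mul_sum]
  rw [Finset.sum_comm]
  simp_rw [Finset.sum_comm (s := Finset.univ), sum_pauliStringSign_mul]
  simp [mul_comm]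

theorem card_le_of_pauliStringSign_eq_one {n : ℕ} (T : Finset (Fin n → Fin 4))
    (hT : ∀ f ∈ T, ∀ g ∈ T, pauliStringSign f g = 1) : T.card ≤ 2 ^ n := by
  rcases T.eq_empty_or_nonempty with rfl | hne
  · simp
  have hle : ∑ h ∈ T, (∑ f ∈ T, pauliStringSign f h) ^ 2 ≤ 4 ^ n * (T.card : ℤ) :=
    (Finset.sum_le_univ_sum_of_nonneg fun _ => sq_nonneg _).trans_eq
      (sum_sq_sum_pauliStringSign T)
  have hconst : ∑ h ∈ T, (∑ f ∈ T, pauliStringSign f h) ^ 2 = (T.card : ℤ) ^ 2 * T.card := by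
    rw [Finset.sum_congr rfl fun h hh => by
      rw [Finset.sum_congr rfl fun f hf => hT f hf h hh]]
    simp [mul_comm]
  rw [hconst] at hle
  have hpos : (0 : ℤ) < T.card := by exact_mod_cast hne.card_pos
  have hsq : T.card ^ 2 ≤ (2 ^ n) ^ 2 := by
    rw [← pow_mul, mul_comm n, pow_mul]
    exact_mod_cast le_of_mul_le_mul_right hle hpos
  exact (Nat.pow_le_pow_iff_left two_ne_zero).mp hsq

/-- **Lemma 11, bound part.** A finite set of pairwise commuting
`n`-qubit Pauli strings has at most `2^n` elements. -/
theorem card_commuting_pauli_set_le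
    {n : ℕ} (hn : 1 ≤ n)
    (S : Finset (Matrix (Fin n → Fin 2) (Fin n → Fin 2) ℂ))
    (hpauli : ∀ A ∈ S, IsPauli A)
    (hcomm : ∀ A ∈ S, ∀ B ∈ S, MComm A B) :
    S.card ≤ 2 ^ n := by
  classical
  let T : Finset (Fin n → Fin 4) := {f | PauliString n f ∈ S}
  have hmem : ∀ f ∈ T, PauliString n f ∈ S := fun f hf => (Finset.mem_filter.mp hf).2
  have hsub : S ⊆ T.image (PauliString n) := by
    intro A hA
    obtain ⟨f, rfl⟩ := hpauli A hA
    exact Finset.mem_image_of_mem _ (Finset.mem_filter.mpr ⟨Finset.mem_univ f, hA⟩)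
  calc S.card ≤ T.card := (Finset.card_le_card hsub).trans Finset.card_image_le
    _ ≤ 2 ^ n := card_le_of_pauliStringSign_eq_one T fun f hf g hg =>
      pauliStringSign_eq_one (hcomm _ (hmem f hf) _ (hmem g hg))
end
end

section
/- Let c > 0 be a real number, let q ≥ 1 be a natural number, let A be a real number with A ≥ c^q, and let a : Fin q → ℝ satisfy a_i ≥ c for all i and ∏_{i} a_i ≤ A. Then ∑_{i} a_i ≤ A / c^{q-1} + c * (q - 1). -/
/-- Bernoulli's inequality for a finite product with nonnegative increments. -/
theorem Finset.one_add_sum_le_prod_one_add {ι R : Type*} [CommSemiring R] [PartialOrder R]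
    [IsOrderedRing R] {s : Finset ι} {f : ι → R} (hf : ∀ i ∈ s, 0 ≤ f i) :
    1 + ∑ i ∈ s, f i ≤ ∏ i ∈ s, (1 + f i) := by
  classical
  induction s using Finset.induction_on with
  | empty => simp
  | insert j s hj ih =>
    rw [Finset.forall_mem_insert] at hf
    obtain ⟨hfj, hfs⟩ := hf
    rw [Finset.sum_insert hj, Finset.prod_insert hj]
    calc 1 + (f j + ∑ i ∈ s, f i)
        ≤ 1 + (f j + ∑ i ∈ s, f i) + f j * ∑ i ∈ s, f i :=
          le_add_of_nonneg_right (mul_nonneg hfj (Finset.sum_nonneg hfs))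
      _ = (1 + f j) * (1 + ∑ i ∈ s, f i) := by ring
      _ ≤ (1 + f j) * ∏ i ∈ s, (1 + f i) :=
          mul_le_mul_of_nonneg_left (ih hfs) (add_nonneg zero_le_one hfj)

/-- **Lemma 12.** For a real constant `c > 0`, a natural number
`q ≥ 1`, a real `A ≥ c^q`, and reals `a i ≥ c` with `∏ i, a i ≤ A`, one has
`∑ i, a i ≤ A / c^(q-1) + c * (q - 1)`. -/
theorem sum_le_of_prod_le
    (c : ℝ) (hc : 0 < c) (q : ℕ) (hq : 1 ≤ q) (A : ℝ) (hA : c ^ q ≤ A)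
    (a : Fin q → ℝ) (ha : ∀ i, c ≤ a i) (hprod : ∏ i, a i ≤ A) :
    ∑ i, a i ≤ A / c ^ (q - 1) + c * ((q : ℝ) - 1) := by
  have bernoulli : 1 + ∑ i, (a i / c - 1) ≤ ∏ i, (1 + (a i / c - 1)) :=
    Finset.one_add_sum_le_prod_one_add fun i _ => sub_nonneg.2 ((one_le_div hc).2 (ha i))
  simp only [add_sub_cancel, Finset.sum_sub_distrib, ← Finset.sum_div, Finset.prod_div_distrib,
    Finset.prod_const, Finset.sum_const, Finset.card_univ, Fintype.card_fin, nsmul_eq_mul,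
    mul_one] at bernoulli
  have hpow : c ^ q = c ^ (q - 1) * c := (pow_sub_one_mul (by lia) c).symm
  calc ∑ i, a i = c * (1 + ((∑ i, a i) / c - q)) + c * ((q : ℝ) - 1) := by field_simp; ring
    _ ≤ c * ((∏ i, a i) / c ^ q) + c * ((q : ℝ) - 1) := by gcongr
    _ = (∏ i, a i) / c ^ (q - 1) + c * ((q : ℝ) - 1) := by rw [hpow]; field_simp
    _ ≤ A / c ^ (q - 1) + c * ((q : ℝ) - 1) := by gcongr
end

section
/- Let n and q be natural numbers with q ≥ 1, and let p, v, w, S be real numbers with p ≥ 0, v ≥ 0, w > 0, S ≥ v, S ≥ w + p, and 4^q * S^2 ≤ 4^n. Then (4^n * v) / (4^{q-1} * S^2) + (3*q - 4) * v + p ≤ 4^n / (q * w) - q * w. -/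
/-- **Eq. (S31) ⇒ Eq. (S32).** For naturals `n` and `q ≥ 1` and
reals `p ≥ 0`, `v ≥ 0`, `w > 0`, `S ≥ v`, `S ≥ w + p` with `4^q * S^2 ≤ 4^n`,
one has `4^n v / (4^(q-1) S^2) + (3q - 4) v + p ≤ 4^n / (q w) - q w`. -/
theorem expressivity_bound_inequality
    (n q : ℕ) (hq : 1 ≤ q) (p v w S : ℝ)
    (hp : 0 ≤ p) (hv : 0 ≤ v) (hw : 0 < w)
    (hSv : v ≤ S) (hSwp : w + p ≤ S)
    (h4 : (4 : ℝ) ^ q * S ^ 2 ≤ (4 : ℝ) ^ n) :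
    ((4 : ℝ) ^ n * v) / ((4 : ℝ) ^ (q - 1) * S ^ 2) + (3 * (q : ℝ) - 4) * v + p ≤
      (4 : ℝ) ^ n / ((q : ℝ) * w) - (q : ℝ) * w := by
  obtain ⟨k, rfl⟩ : ∃ k, q = k + 1 := ⟨q - 1, by omega⟩
  rw [Nat.add_sub_cancel]
  have hsq : ((k + 1 : ℕ) : ℝ) ^ 2 ≤ 4 ^ k := by
    have h : (k + 1) ^ 2 ≤ 4 ^ k := by
      calc (k + 1) ^ 2 ≤ (2 ^ k) ^ 2 := Nat.pow_le_pow_left Nat.lt_two_pow_self 2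
        _ = 4 ^ k := by rw [← pow_mul, mul_comm, pow_mul]; norm_num
    exact_mod_cast h
  rw [pow_succ] at h4
  have hr : (1 : ℝ) ≤ (k + 1 : ℕ) := by exact_mod_cast hq
  have hA : (0 : ℝ) < 4 ^ k := by positivity
  generalize ((k + 1 : ℕ) : ℝ) = r at *
  generalize (4 : ℝ) ^ k = A at *
  obtain ⟨D, hD⟩ : ∃ D, (4 : ℝ) ^ n = 4 * A * S ^ 2 + D := ⟨4 ^ n - 4 * A * S ^ 2, by ring⟩
  rw [hD] at h4 ⊢
  have hD0 : 0 ≤ D := by linarith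
  have hwS : w ≤ S := by linarith
  have hS : 0 < S := by linarith
  have hrw : 0 < r * w := by positivity
  have hleft : (4 * A * S ^ 2 + D) * v / (A * S ^ 2) = 4 * v + D * (v / (A * S ^ 2)) := by
    field_simp
  have hright : (4 * A * S ^ 2 + D) / (r * w) = 4 * A * S ^ 2 / (r * w) + D * (1 / (r * w)) := by
    ring
  have hcoeff : v / (A * S ^ 2) ≤ 1 / (r * w) := by
    rw [div_le_div_iff₀ (by positivity) hrw]
    have hvw : v * w ≤ S * S := mul_le_mul hSv hwS hw.le hS.le
    have hrA : r ≤ A := by nlinarith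
    calc v * (r * w) = r * (v * w) := by ring
      _ ≤ A * (S * S) := mul_le_mul hrA hvw (by positivity) hA.le
      _ = 1 * (A * S ^ 2) := by ring
  have hmain : 4 * r * S ≤ 4 * A * S ^ 2 / (r * w) := by
    rw [le_div_iff₀ hrw]
    calc 4 * r * S * (r * w) = 4 * S * (r ^ 2 * w) := by ring
      _ ≤ 4 * S * (A * S) := by gcongr
      _ = 4 * A * S ^ 2 := by ring
  have hDle := mul_le_mul_of_nonneg_left hcoeff hD0
  have hrv : r * v ≤ r * S := by gcongr
  have hrwS : (r - 1) * w ≤ (r - 1) * S := mul_le_mul_of_nonneg_left hwS (by linarith)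
  rw [hleft, hright]
  linarith
end
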